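/- Fix k ≥ 2 and let M_k(z) be the Jacobian matrix of the type-refined system for Av(231), with entries M_k(z)_{t,u} = (∂F_t/∂C_u)(z; C_v(z), v ∈ 𝒯_k). For every |z| ≤ 1/4 and every column u ∈ 𝒯_k, the column sum Σ_{t ∈ 𝒯_k} M_k(z)_{t,u} equals 2z·C(z), where C is the Catalan generating function; in particular at z = 1/4 every column sum equals 1. -/

import Mathlib

open FirstOrder Filter Asymptotics Topology

namespace Av231

/-- Relation symbols of the theory of two orders: two binary relations `<_P` and `<_V`. -/
inductive TwoRel : ℕ → Type
  | lp : TwoRel 2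
  | lv : TwoRel 2

/-- The first-order language with two binary relation symbols `<_P` and `<_V`. -/
def L : Language := ⟨fun _ => Empty, TwoRel⟩

/-- The `L`-structure on `Fin n` associated with a permutation `σ` of `{1,…,n}`:
`i <_P j` iff `i < j` and `i <_V j` iff `σ i < σ j`. -/
def pStruct {n : ℕ} (σ : Equiv.Perm (Fin n)) : L.Structure (Fin n) where
  funMap := fun f _ => nomatch f
  RelMap := fun r x =>
    match r with
    | .lp => x 0 < x 1
    | .lv => σ (x 0) < σ (x 1)

/-- A permutation satisfies a first-order sentence. -/
def Sat {n : ℕ} (σ : Equiv.Perm (Fin n)) (ψ : L.Sentence) : Prop :=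
  @Language.Sentence.Realize L (Fin n) (pStruct σ) ψ

/-- The quantifier depth of a first-order formula. -/
def qd {L' : Language} {α : Type*} : ∀ {n : ℕ}, L'.BoundedFormula α n → ℕ
  | _, .falsum => 0
  | _, .equal _ _ => 0
  | _, .rel _ _ => 0
  | _, .imp f g => max (qd f) (qd g)
  | _, .all f => qd f + 1

/-- A permutation avoids the pattern `231`. -/
def Avoids {n : ℕ} (σ : Equiv.Perm (Fin n)) : Prop :=
  ¬ ∃ i j k : Fin n, i < j ∧ j < k ∧ σ k < σ i ∧ σ i < σ j

/-- The number of `231`-avoiding permutations of size `n` satisfying `ψ`. -/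
noncomputable def avN (n : ℕ) (ψ : L.Sentence) : ℕ :=
  Nat.card {σ : Equiv.Perm (Fin n) // Avoids σ ∧ Sat σ ψ}

/-- The probability that a uniform random `231`-avoiding permutation of size `n`
satisfies `ψ` (the number of `231`-avoiding permutations of size `n` is `catalan n`). -/
noncomputable def prob (n : ℕ) (ψ : L.Sentence) : ℝ :=
  (avN n ψ : ℝ) / (catalan n : ℝ)

/-- Permutations of arbitrary finite size. -/
abbrev FinPerm := Σ n : ℕ, Equiv.Perm (Fin n)

def AvoidsF (p : FinPerm) : Prop := Avoids p.2

/-- Direct sum of permutations. -/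
def dsum {a b : ℕ} (σ : Equiv.Perm (Fin a)) (τ : Equiv.Perm (Fin b)) :
    Equiv.Perm (Fin (a + b)) :=
  finSumFinEquiv.permCongr (Equiv.sumCongr σ τ)

/-- Skew sum of permutations. -/
def ssum {a b : ℕ} (σ : Equiv.Perm (Fin a)) (τ : Equiv.Perm (Fin b)) :
    Equiv.Perm (Fin (a + b)) :=
  finSumFinEquiv.symm.trans ((Equiv.sumCongr σ τ).trans
    ((Equiv.sumComm (Fin a) (Fin b)).trans (finSumFinEquiv.trans (finCongr (Nat.add_comm b a)))))

/-- The operation `(τ, π) ↦ τ ⊕ (1 ⊖ π)` on permutations of arbitrary sizes. -/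
def glue (τ π : FinPerm) : FinPerm :=
  ⟨τ.1 + (1 + π.1), dsum τ.2 (ssum (1 : Equiv.Perm (Fin 1)) π.2)⟩

/-- Two permutations are `k`-equivalent when they satisfy the same first-order sentences
of quantifier depth at most `k`. -/
def kEquiv (k : ℕ) (p q : FinPerm) : Prop :=
  ∀ ψ : L.Sentence, qd ψ ≤ k → (Sat p.2 ψ ↔ Sat q.2 ψ)

end Av231

/-- `k`-equivalence as a setoid on finite permutations. -/
def kSetoid (k : ℕ) : Setoid Av231.FinPerm :=
  ⟨Av231.kEquiv k,
    ⟨fun _ _ _ => Iff.rfl, fun h ψ hψ => (h ψ hψ).symm,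
      fun h h' ψ hψ => (h ψ hψ).trans (h' ψ hψ)⟩⟩

namespace Av231

/-- Logical types of order `k`: equivalence classes of `≡ₖ`. -/
def QT (k : ℕ) := Quotient (kSetoid k)

/-- The logical type of order `k` of a permutation. -/
def typeOf (k : ℕ) (p : FinPerm) : QT k := Quotient.mk (kSetoid k) p

/-- A type is realized when some `231`-avoiding permutation has this type;
`𝒯ₖ` consists of the realized types. -/
def Realized (k : ℕ) (t : QT k) : Prop := ∃ p : FinPerm, AvoidsF p ∧ typeOf k p = t

/-- The number of `231`-avoiding permutations of size `n` whose logical type of order `k`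
is `t`, i.e. the `n`-th coefficient of the generating series `C_t`. -/
noncomputable def cnt (k : ℕ) (t : QT k) (n : ℕ) : ℕ :=
  Nat.card {σ : Equiv.Perm (Fin n) // Avoids σ ∧ typeOf k ⟨n, σ⟩ = t}

/-- The type of the empty permutation. -/
def emptyType (k : ℕ) : QT k := typeOf k ⟨0, 1⟩

/-- `H_k(t₁,t₂)`: the type of `τ ⊕ (1 ⊖ π)` where `τ, π` are representatives
of `t₁, t₂` respectively. -/
noncomputable def Hfun (k : ℕ) (t₁ t₂ : QT k) : QT k :=
  typeOf k (glue (Quotient.out t₁) (Quotient.out t₂))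

/-- The edge relation `u → t` of the dependency graph `G_k`:
`∂F_t/∂C_u ≠ 0`, i.e. some `v ∈ 𝒯ₖ` satisfies `H_k(u,v) = t` or `H_k(v,u) = t`. -/
def Edge (k : ℕ) (u t : QT k) : Prop :=
  ∃ v : QT k, Realized k v ∧ (Hfun k u v = t ∨ Hfun k v u = t)

/-- The set `𝒯ₖ` of types realized by `231`-avoiding permutations, as a type. -/
def Tk (k : ℕ) := {t : QT k // Realized k t}

/-- The edge relation of `G_k` restricted to `𝒯ₖ`. -/
def EdgeT (k : ℕ) (u t : Tk k) : Prop := Edge k u.1 t.1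

/-- `S` is a terminal strongly connected component of the dependency graph `G_k`:
it is nonempty, any vertex of `S` reaches any other, and no edge leaves `S`
(this forces maximality, hence being an SCC). -/
def IsTermSCC (k : ℕ) (S : Set (Tk k)) : Prop :=
  S.Nonempty ∧ (∀ u ∈ S, ∀ v ∈ S, Relation.ReflTransGen (EdgeT k) u v) ∧
    (∀ u ∈ S, ∀ v : Tk k, EdgeT k u v → v ∈ S)

/-- A sequence of coefficients is periodic when, for some `d ≥ 2` and `r`,
it vanishes outside `dℤ + r`. -/
def SeqPeriodic (a : ℕ → ℝ) : Prop :=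
  ∃ d : ℕ, 2 ≤ d ∧ ∃ r : ℕ, ∀ n : ℕ, n % d ≠ r % d → a n = 0

/-- The generating series `C_t` of `231`-avoiding permutations of type `t`,
evaluated at a complex number `z`. -/
noncomputable def Ct (k : ℕ) (t : QT k) (z : ℂ) : ℂ :=
  ∑' n : ℕ, (cnt k t n : ℂ) * z ^ n

/-- The Catalan generating function. -/
noncomputable def catGF (z : ℂ) : ℂ := ∑' n : ℕ, (catalan n : ℂ) * z ^ n

/-- The entry `M_k(z)_{t,u} = ∂F_t/∂C_u (z; C_v(z), v ∈ 𝒯ₖ)` of the Jacobian matrix of the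
type-refined system. -/
noncomputable def Mmat (k : ℕ) (z : ℂ) (t u : QT k) : ℂ :=
  z * ((∑' v : {v : QT k // Realized k v ∧ Hfun k u v = t}, Ct k v.1 z) +
       (∑' v : {v : QT k // Realized k v ∧ Hfun k v u = t}, Ct k v.1 z))

/-- `lam` is an eigenvalue of the (possibly infinite) matrix `A`, witnessed by a finitely
supported eigenvector. For finite index types this is the usual notion of eigenvalue. -/
def IsEig {α : Type*} (A : α → α → ℂ) (lam : ℂ) : Prop :=
  ∃ v : α →₀ ℂ, v ≠ 0 ∧ ∀ x : α, ∑ y ∈ v.support, A x y * v y = lam * v x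

/-- Realization of a formula without free named variables in the structure of a permutation. -/
def Rz {n j : ℕ} (σ : Equiv.Perm (Fin n)) (φ : L.BoundedFormula Empty j) (a : Fin j → Fin n) :
    Prop :=
  @Language.BoundedFormula.Realize L (Fin n) (pStruct σ) Empty j φ default a

theorem Rz_imp {n j : ℕ} (σ : Equiv.Perm (Fin n)) (φ ψ : L.BoundedFormula Empty j)
    (a : Fin j → Fin n) : Rz σ (φ.imp ψ) a ↔ (Rz σ φ a → Rz σ ψ a) := Iff.rfl

theorem Rz_all {n j : ℕ} (σ : Equiv.Perm (Fin n)) (φ : L.BoundedFormula Empty (j + 1))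
    (a : Fin j → Fin n) : Rz σ φ.all a ↔ ∀ x, Rz σ φ (Fin.snoc a x) := Iff.rfl

/-- A set of pairs that preserves and reflects both orders of two permutations. -/
def PartialIso {n m : ℕ} (σ : Equiv.Perm (Fin n)) (τ : Equiv.Perm (Fin m))
    (S : Set (Fin n × Fin m)) : Prop :=
  ∀ p ∈ S, ∀ q ∈ S, (p.1 < q.1 ↔ p.2 < q.2) ∧ (σ p.1 < σ q.1 ↔ τ p.2 < τ q.2)

/-- Duplicator wins the `r`-round Ehrenfeucht–Fraïssé game from position `S`. -/
def BackForth {n m : ℕ} (σ : Equiv.Perm (Fin n)) (τ : Equiv.Perm (Fin m)) :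
    ℕ → Set (Fin n × Fin m) → Prop
  | 0, S => PartialIso σ τ S
  | r + 1, S => PartialIso σ τ S ∧
      (∀ x, ∃ y, BackForth σ τ r (insert (x, y) S)) ∧
      (∀ y, ∃ x, BackForth σ τ r (insert (x, y) S))

theorem BackForth.partialIso {n m : ℕ} {σ : Equiv.Perm (Fin n)} {τ : Equiv.Perm (Fin m)} {r : ℕ}
    {S : Set (Fin n × Fin m)} (h : BackForth σ τ r S) : PartialIso σ τ S := by
  cases r with
  | zero => exact h
  | succ r => exact h.1

theorem BackForth.of_succ {n m : ℕ} {σ : Equiv.Perm (Fin n)} {τ : Equiv.Perm (Fin m)} {r : ℕ}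
    {S : Set (Fin n × Fin m)} (h : BackForth σ τ (r + 1) S) : BackForth σ τ r S := by
  induction r generalizing S with
  | zero => exact h.1
  | succ r ih =>
    refine ⟨h.1, fun x => ?_, fun y => ?_⟩
    · obtain ⟨y, hy⟩ := h.2.1 x
      exact ⟨y, ih hy⟩
    · obtain ⟨x, hx⟩ := h.2.2 y
      exact ⟨x, ih hx⟩

theorem term_eq_var {j : ℕ} (t : L.Term (Empty ⊕ Fin j)) : ∃ i, t = .var (.inr i) := by
  cases t with
  | var v =>
    rcases v with v | v
    · exact v.elim
    · exact ⟨v, rfl⟩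
  | func f => exact Empty.elim f

/-- Winning positions of the game preserve formulas of bounded quantifier depth. -/
theorem BackForth.Rz_iff {n m j r : ℕ} {σ : Equiv.Perm (Fin n)} {τ : Equiv.Perm (Fin m)}
    {S : Set (Fin n × Fin m)} (h : BackForth σ τ r S) (φ : L.BoundedFormula Empty j)
    (hφ : qd φ ≤ r) (a : Fin j → Fin n) (b : Fin j → Fin m) (hab : ∀ i, (a i, b i) ∈ S) :
    Rz σ φ a ↔ Rz τ φ b := by
  induction φ generalizing r S with
  | falsum => exact Iff.rfl
  | equal t₁ t₂ =>
    obtain ⟨i, rfl⟩ := term_eq_var t₁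
    obtain ⟨i', rfl⟩ := term_eq_var t₂
    have h₁ := (h.partialIso _ (hab i) _ (hab i')).1
    have h₂ := (h.partialIso _ (hab i') _ (hab i)).1
    change a i = a i' ↔ b i = b i'
    simp only at h₁ h₂
    omega
  | rel R ts =>
    cases R with
    | lp =>
      obtain ⟨i, hi⟩ := term_eq_var (ts 0)
      obtain ⟨i', hi'⟩ := term_eq_var (ts 1)
      have h₁ := (h.partialIso _ (hab i) _ (hab i')).1
      change (@Language.Term.realize L _ (pStruct σ) _ _ (ts 0) <
          @Language.Term.realize L _ (pStruct σ) _ _ (ts 1)) ↔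
        (@Language.Term.realize L _ (pStruct τ) _ _ (ts 0) <
          @Language.Term.realize L _ (pStruct τ) _ _ (ts 1))
      rw [hi, hi']
      exact h₁
    | lv =>
      obtain ⟨i, hi⟩ := term_eq_var (ts 0)
      obtain ⟨i', hi'⟩ := term_eq_var (ts 1)
      have h₁ := (h.partialIso _ (hab i) _ (hab i')).2
      change (σ (@Language.Term.realize L _ (pStruct σ) _ _ (ts 0)) <
          σ (@Language.Term.realize L _ (pStruct σ) _ _ (ts 1))) ↔
        (τ (@Language.Term.realize L _ (pStruct τ) _ _ (ts 0)) <
          τ (@Language.Term.realize L _ (pStruct τ) _ _ (ts 1)))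
      rw [hi, hi']
      exact h₁
  | imp f g ihf ihg =>
    simp only [qd, max_le_iff] at hφ
    rw [Rz_imp, Rz_imp, ihf h hφ.1 a b hab, ihg h hφ.2 a b hab]
  | all f ih =>
    cases r with
    | zero => simp [qd] at hφ
    | succ r =>
      have hf : qd f ≤ r := by simpa [qd] using hφ
      have key : ∀ x y, BackForth σ τ r (insert (x, y) S) →
          (Rz σ f (Fin.snoc a x) ↔ Rz τ f (Fin.snoc b y)) := by
        intro x y hxy
        refine ih hxy hf _ _ fun i => ?_
        refine Fin.lastCases ?_ (fun i => ?_) i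
        · simp
        · simp [hab i]
      rw [Rz_all, Rz_all]
      constructor
      · intro hx y
        obtain ⟨x, hxy⟩ := h.2.2 y
        exact (key x y hxy).1 (hx x)
      · intro hy x
        obtain ⟨y, hxy⟩ := h.2.1 x
        exact (key x y hxy).2 (hy y)

/-- Agreement on formulas of depth `r + 1` extends to agreement of depth `r` after one move. -/
theorem exists_response {n m j r : ℕ} {σ : Equiv.Perm (Fin n)} {τ : Equiv.Perm (Fin m)}
    {a : Fin j → Fin n} {b : Fin j → Fin m}
    (h : ∀ φ : L.BoundedFormula Empty j, qd φ ≤ r + 1 → (Rz σ φ a ↔ Rz τ φ b)) (x : Fin n) :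
    ∃ y, ∀ φ : L.BoundedFormula Empty (j + 1), qd φ ≤ r →
      (Rz σ φ (Fin.snoc a x) ↔ Rz τ φ (Fin.snoc b y)) := by
  by_contra! hcon
  have separate : ∀ y, ∃ φ : L.BoundedFormula Empty (j + 1), qd φ ≤ r ∧
      Rz σ φ (Fin.snoc a x) ∧ ¬ Rz τ φ (Fin.snoc b y) := by
    intro y
    obtain ⟨φ, hφ, hne⟩ := hcon y
    rcases hne with hne | hne
    · exact ⟨φ, hφ, hne⟩
    · exact ⟨φ.imp .falsum, by simpa [qd] using hφ, hne.1, fun hn => hn hne.2⟩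
  have conj : ∀ s : Finset (Fin m), ∃ φ : L.BoundedFormula Empty (j + 1), qd φ ≤ r ∧
      ¬ Rz σ φ (Fin.snoc a x) ∧ ∀ y ∈ s, Rz τ φ (Fin.snoc b y) := by
    intro s
    induction s using Finset.induction_on with
    | empty => exact ⟨.falsum, by simp [qd], id, by simp⟩
    | insert y s _ ih =>
      obtain ⟨φ, hφ, hx, hs⟩ := ih
      obtain ⟨χ, hχ, hχx, hχy⟩ := separate y
      refine ⟨χ.imp φ, by simp [qd, hφ, hχ], fun hi => hx (hi hχx), fun z hz => ?_⟩
      rw [Rz_imp]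
      rcases Finset.mem_insert.1 hz with rfl | hz
      · exact fun hc => (hχy hc).elim
      · exact fun _ => hs z hz
  obtain ⟨φ, hφ, hx, hs⟩ := conj Finset.univ
  exact hx ((h φ.all (by simpa [qd] using hφ)).2 (fun y => hs y (Finset.mem_univ y)) x)

theorem range_snoc_pair {α β : Type*} {j : ℕ} (a : Fin j → α) (b : Fin j → β) (x : α) (y : β) :
    Set.range (fun i : Fin (j + 1) => ((Fin.snoc a x : Fin (j + 1) → α) i,
      (Fin.snoc b y : Fin (j + 1) → β) i)) =
      insert (x, y) (Set.range fun i => (a i, b i)) := by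
  ext p
  simp only [Set.mem_range, Set.mem_insert_iff]
  rw [Fin.exists_fin_succ']
  simp [or_comm, eq_comm]

/-- Tuples agreeing on formulas of depth `r` form a winning position of the `r`-round game. -/
theorem backForth_of_Rz_iff {n m j r : ℕ} {σ : Equiv.Perm (Fin n)} {τ : Equiv.Perm (Fin m)}
    {a : Fin j → Fin n} {b : Fin j → Fin m}
    (h : ∀ φ : L.BoundedFormula Empty j, qd φ ≤ r → (Rz σ φ a ↔ Rz τ φ b)) :
    BackForth σ τ r (Set.range fun i => (a i, b i)) := by
  have hiso : PartialIso σ τ (Set.range fun i => (a i, b i)) := by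
    rintro _ ⟨i, rfl⟩ _ ⟨i', rfl⟩
    exact ⟨h (.rel (l := 2) TwoRel.lp ![.var (.inr i), .var (.inr i')]) (Nat.zero_le _),
      h (.rel (l := 2) TwoRel.lv ![.var (.inr i), .var (.inr i')]) (Nat.zero_le _)⟩
  induction r generalizing j with
  | zero => exact hiso
  | succ r ih =>
    have step : ∀ x y, (∀ φ : L.BoundedFormula Empty (j + 1), qd φ ≤ r →
        (Rz σ φ (Fin.snoc a x) ↔ Rz τ φ (Fin.snoc b y))) →
        BackForth σ τ r (insert (x, y) (Set.range fun i => (a i, b i))) := by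
      intro x y hxy
      rw [← range_snoc_pair]
      refine ih hxy ?_
      rintro _ ⟨i, rfl⟩ _ ⟨i', rfl⟩
      exact ⟨hxy (.rel (l := 2) TwoRel.lp ![.var (.inr i), .var (.inr i')]) (Nat.zero_le _),
        hxy (.rel (l := 2) TwoRel.lv ![.var (.inr i), .var (.inr i')]) (Nat.zero_le _)⟩
    refine ⟨hiso, fun x => ?_, fun y => ?_⟩
    · obtain ⟨y, hy⟩ := exists_response h x
      exact ⟨y, step x y hy⟩
    · obtain ⟨x, hx⟩ := exists_response (fun φ hφ => (h φ hφ).symm) y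
      exact ⟨x, step x y fun φ hφ => (hx φ hφ).symm⟩

theorem kEquiv_iff_backForth (k : ℕ) (p q : FinPerm) :
    kEquiv k p q ↔ BackForth p.2 q.2 k ∅ := by
  constructor
  · intro h
    have := backForth_of_Rz_iff (σ := p.2) (τ := q.2) (r := k) (a := default) (b := default) h
    rwa [Set.range_eq_empty] at this
  · intro h ψ hψ
    exact h.Rz_iff ψ hψ default default fun i => i.elim0

/-- Position in `glue p q` of a point of `p`. -/
def gl (p q : FinPerm) (i : Fin p.1) : Fin (glue p q).1 := Fin.castAdd (1 + q.1) i

/-- Position in `glue p q` of the new maximum. -/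
def gm (p q : FinPerm) : Fin (glue p q).1 := Fin.natAdd p.1 (Fin.castAdd q.1 (0 : Fin 1))

/-- Position in `glue p q` of a point of `q`. -/
def gr (p q : FinPerm) (i : Fin q.1) : Fin (glue p q).1 := Fin.natAdd p.1 (Fin.natAdd 1 i)

theorem glue_size (p q : FinPerm) : (glue p q).1 = p.1 + (1 + q.1) := rfl

theorem gl_val (p q : FinPerm) (i : Fin p.1) : (gl p q i).val = i := rfl

theorem gm_val (p q : FinPerm) : (gm p q).val = p.1 := rfl

theorem gr_val (p q : FinPerm) (i : Fin q.1) : (gr p q i).val = p.1 + (1 + i) := rfl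

theorem dsum_castAdd {a b : ℕ} (σ : Equiv.Perm (Fin a)) (τ : Equiv.Perm (Fin b)) (i : Fin a) :
    dsum σ τ (Fin.castAdd b i) = Fin.castAdd b (σ i) := by
  simp [dsum]

theorem dsum_natAdd {a b : ℕ} (σ : Equiv.Perm (Fin a)) (τ : Equiv.Perm (Fin b)) (i : Fin b) :
    dsum σ τ (Fin.natAdd a i) = Fin.natAdd a (τ i) := by
  simp [dsum]

theorem ssum_castAdd {a b : ℕ} (σ : Equiv.Perm (Fin a)) (τ : Equiv.Perm (Fin b)) (i : Fin a) :
    (ssum σ τ (Fin.castAdd b i)).val = b + σ i := by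
  simp [ssum, Nat.add_comm]

theorem ssum_natAdd {a b : ℕ} (σ : Equiv.Perm (Fin a)) (τ : Equiv.Perm (Fin b)) (i : Fin b) :
    (ssum σ τ (Fin.natAdd a i)).val = τ i := by
  simp [ssum]

theorem glue_gl (p q : FinPerm) (i : Fin p.1) : ((glue p q).2 (gl p q i)).val = p.2 i :=
  congrArg Fin.val (dsum_castAdd p.2 (ssum 1 q.2) i)

theorem glue_gm (p q : FinPerm) : ((glue p q).2 (gm p q)).val = p.1 + q.1 :=
  (congrArg Fin.val (dsum_natAdd p.2 (ssum 1 q.2) _)).trans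
    (congrArg (p.1 + ·) (ssum_castAdd 1 q.2 0))

theorem glue_gr (p q : FinPerm) (i : Fin q.1) :
    ((glue p q).2 (gr p q i)).val = p.1 + q.2 i :=
  (congrArg Fin.val (dsum_natAdd p.2 (ssum 1 q.2) _)).trans
    (congrArg (p.1 + ·) (ssum_natAdd 1 q.2 i))

theorem glue_cases (p q : FinPerm) (x : Fin (glue p q).1) :
    (∃ i, x = gl p q i) ∨ x = gm p q ∨ ∃ i, x = gr p q i := by
  have hx : x.val < p.1 + (1 + q.1) := x.2
  rcases lt_trichotomy x.val p.1 with h | h | h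
  · exact .inl ⟨⟨x, h⟩, rfl⟩
  · exact .inr (.inl (Fin.ext h))
  · refine .inr (.inr ⟨⟨x - p.1 - 1, by omega⟩, Fin.ext ?_⟩)
    rw [gr_val]
    simp only
    omega

/-- The pairs of positions of two glued permutations matched by `S` on the left, by `T` on the
right, together with the pair of maxima. -/
def gluePairs (p q p' q' : FinPerm) (S : Set (Fin p.1 × Fin p'.1)) (T : Set (Fin q.1 × Fin q'.1)) :
    Set (Fin (glue p q).1 × Fin (glue p' q').1) :=
  {x | (∃ y ∈ S, x = (gl p q y.1, gl p' q' y.2)) ∨ x = (gm p q, gm p' q') ∨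
    ∃ y ∈ T, x = (gr p q y.1, gr p' q' y.2)}

theorem gluePairs_mono {p q p' q' : FinPerm} {S S' : Set (Fin p.1 × Fin p'.1)}
    {T T' : Set (Fin q.1 × Fin q'.1)} (hS : S ⊆ S') (hT : T ⊆ T') :
    gluePairs p q p' q' S T ⊆ gluePairs p q p' q' S' T' := by
  rintro x (⟨y, hy, rfl⟩ | rfl | ⟨y, hy, rfl⟩)
  · exact .inl ⟨y, hS hy, rfl⟩
  · exact .inr (.inl rfl)
  · exact .inr (.inr ⟨y, hT hy, rfl⟩)

theorem PartialIso.glue {p q p' q' : FinPerm} {S : Set (Fin p.1 × Fin p'.1)}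
    {T : Set (Fin q.1 × Fin q'.1)} (hS : PartialIso p.2 p'.2 S) (hT : PartialIso q.2 q'.2 T) :
    PartialIso (glue p q).2 (Av231.glue p' q').2 (gluePairs p q p' q' S T) := by
  rintro _ (⟨x, hx, rfl⟩ | rfl | ⟨x, hx, rfl⟩) _ (⟨y, hy, rfl⟩ | rfl | ⟨y, hy, rfl⟩) <;>
  simp only [Fin.lt_def, glue_gl, glue_gm, glue_gr, gl_val, gm_val, gr_val]
  · simpa only [Fin.lt_def] using hS x hx y hy
  · omega
  · omega
  · omega
  · omega
  · omega
  · omega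
  · omega
  · have := hT x hx y hy
    simp only [Fin.lt_def] at this
    omega

/-- Winning strategies on the two parts combine to a winning strategy on the glued permutations. -/
theorem BackForth.glue {p q p' q' : FinPerm} {r : ℕ} {S : Set (Fin p.1 × Fin p'.1)}
    {T : Set (Fin q.1 × Fin q'.1)} {U : Set (Fin (glue p q).1 × Fin (Av231.glue p' q').1)}
    (hS : BackForth p.2 p'.2 r S) (hT : BackForth q.2 q'.2 r T)
    (hU : U ⊆ gluePairs p q p' q' S T) :
    BackForth (Av231.glue p q).2 (Av231.glue p' q').2 r U := by
  have hiso : PartialIso (Av231.glue p q).2 (Av231.glue p' q').2 U := fun x hx y hy =>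
    hS.partialIso.glue hT.partialIso x (hU hx) y (hU hy)
  induction r generalizing S T U with
  | zero => exact hiso
  | succ r ih =>
    have left : ∀ x y, BackForth p.2 p'.2 r (insert (x, y) S) →
        BackForth (Av231.glue p q).2 (Av231.glue p' q').2 r
          (insert (gl p q x, gl p' q' y) U) := by
      intro x y h
      have hsub := Set.insert_subset (a := (gl p q x, gl p' q' y))
        (.inl ⟨(x, y), Set.mem_insert _ _, rfl⟩)
        (hU.trans (gluePairs_mono (Set.subset_insert (x, y) S) subset_rfl))
      exact ih h hT.of_succ hsub fun x hx y hy =>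
        h.partialIso.glue hT.partialIso x (hsub hx) y (hsub hy)
    have middle : BackForth (Av231.glue p q).2 (Av231.glue p' q').2 r
        (insert (gm p q, gm p' q') U) := by
      have hsub := Set.insert_subset (a := (gm p q, gm p' q')) (.inr (.inl rfl)) hU
      exact ih hS.of_succ hT.of_succ hsub fun x hx y hy =>
        hS.partialIso.glue hT.partialIso x (hsub hx) y (hsub hy)
    have right : ∀ x y, BackForth q.2 q'.2 r (insert (x, y) T) →
        BackForth (Av231.glue p q).2 (Av231.glue p' q').2 r
          (insert (gr p q x, gr p' q' y) U) := by
      intro x y h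
      have hsub := Set.insert_subset (a := (gr p q x, gr p' q' y))
        (.inr (.inr ⟨(x, y), Set.mem_insert _ _, rfl⟩))
        (hU.trans (gluePairs_mono subset_rfl (Set.subset_insert (x, y) T)))
      exact ih hS.of_succ h hsub fun x hx y hy =>
        hS.partialIso.glue h.partialIso x (hsub hx) y (hsub hy)
    refine ⟨hiso, fun x => ?_, fun y => ?_⟩
    · rcases glue_cases p q x with ⟨i, rfl⟩ | rfl | ⟨i, rfl⟩
      · obtain ⟨y, hy⟩ := hS.2.1 i
        exact ⟨_, left i y hy⟩
      · exact ⟨_, middle⟩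
      · obtain ⟨y, hy⟩ := hT.2.1 i
        exact ⟨_, right i y hy⟩
    · rcases glue_cases p' q' y with ⟨i, rfl⟩ | rfl | ⟨i, rfl⟩
      · obtain ⟨x, hx⟩ := hS.2.2 i
        exact ⟨_, left x i hx⟩
      · exact ⟨_, middle⟩
      · obtain ⟨x, hx⟩ := hT.2.2 i
        exact ⟨_, right x i hx⟩

theorem kEquiv.glue {k : ℕ} {p q p' q' : FinPerm} (hp : kEquiv k p p') (hq : kEquiv k q q') :
    kEquiv k (Av231.glue p q) (Av231.glue p' q') := by
  rw [kEquiv_iff_backForth] at *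
  exact hp.glue hq (Set.empty_subset _)

theorem Hfun_typeOf (k : ℕ) (p q : FinPerm) :
    Hfun k (typeOf k p) (typeOf k q) = typeOf k (glue p q) :=
  Quotient.sound (s := kSetoid k)
    (kEquiv.glue (Quotient.mk_out (s := kSetoid k) p) (Quotient.mk_out (s := kSetoid k) q))

theorem avoidsF_glue_iff {p q : FinPerm} : AvoidsF (glue p q) ↔ AvoidsF p ∧ AvoidsF q := by
  constructor
  · refine fun h => ⟨?_, ?_⟩
    · rintro ⟨i, j, k, hij, hjk, h₁, h₂⟩
      refine h ⟨gl p q i, gl p q j, gl p q k, ?_⟩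
      simp only [Fin.lt_def, glue_gl, gl_val]
      exact ⟨hij, hjk, h₁, h₂⟩
    · rintro ⟨i, j, k, hij, hjk, h₁, h₂⟩
      refine h ⟨gr p q i, gr p q j, gr p q k, ?_⟩
      simp only [Fin.lt_def, glue_gr, gr_val] at *
      omega
  · rintro ⟨hp, hq⟩ ⟨i, j, k, hij, hjk, h₁, h₂⟩
    rcases glue_cases p q i with ⟨i, rfl⟩ | rfl | ⟨i, rfl⟩ <;>
    rcases glue_cases p q j with ⟨j, rfl⟩ | rfl | ⟨j, rfl⟩ <;>
    rcases glue_cases p q k with ⟨k, rfl⟩ | rfl | ⟨k, rfl⟩ <;>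
    simp only [Fin.lt_def, glue_gl, glue_gm, glue_gr, gl_val, gm_val, gr_val] at hij hjk h₁ h₂ <;>
    first
    | omega
    | exact hp ⟨i, j, k, hij, hjk, h₁, h₂⟩
    | exact hq ⟨i, j, k, by omega, by omega, by omega, by omega⟩

theorem Realized.Hfun {k : ℕ} {u v : QT k} (hu : Realized k u) (hv : Realized k v) :
    Realized k (Hfun k u v) := by
  obtain ⟨p, hp, rfl⟩ := hu
  obtain ⟨q, hq, rfl⟩ := hv
  exact ⟨glue p q, avoidsF_glue_iff.2 ⟨hp, hq⟩, (Hfun_typeOf k p q).symm⟩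

theorem FinPerm.ext_val {p q : FinPerm} (h : p.1 = q.1)
    (hv : ∀ (i : ℕ) (hp : i < p.1) (hq : i < q.1), (p.2 ⟨i, hp⟩).val = q.2 ⟨i, hq⟩) : p = q := by
  obtain ⟨n, σ⟩ := p
  obtain ⟨m, τ⟩ := q
  obtain rfl : n = m := h
  congr
  ext i
  exact hv i i.2 i.2

theorem FinPerm.val_congr {p q : FinPerm} (h : p = q) (i : Fin p.1) (j : Fin q.1)
    (hij : i.val = j.val) : (p.2 i).val = q.2 j := by
  subst h
  rw [Fin.ext hij]

theorem glue_injective {p q p' q' : FinPerm} (h : glue p q = glue p' q') : p = p' ∧ q = q' := by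
  have hsize : p.1 + (1 + q.1) = p'.1 + (1 + q'.1) := congrArg Sigma.fst h
  have hp : p.1 = p'.1 := by
    have hm := FinPerm.val_congr h (gm p q) ⟨p.1, by rw [glue_size]; omega⟩ (gm_val p q)
    have : (⟨p.1, by rw [glue_size]; omega⟩ : Fin (glue p' q').1) = gm p' q' := by
      apply (glue p' q').2.injective
      apply Fin.ext
      rw [← hm, glue_gm, glue_gm]
      omega
    exact congrArg Fin.val this
  refine ⟨FinPerm.ext_val hp fun i hi hi' => ?_, FinPerm.ext_val (by omega) fun i hi hi' => ?_⟩
  · have := FinPerm.val_congr h (gl p q ⟨i, hi⟩) (gl p' q' ⟨i, hi'⟩) rfl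
    rwa [glue_gl, glue_gl] at this
  · have := FinPerm.val_congr h (gr p q ⟨i, hi⟩) (gr p' q' ⟨i, hi'⟩) (by
      simp only [gr_val]
      omega)
    rw [glue_gr, glue_gr] at this
    omega

/-- Every nonempty permutation avoiding `231` splits at its maximum. -/
theorem exists_glue {n : ℕ} (σ : Equiv.Perm (Fin (n + 1))) (hσ : Avoids σ) :
    ∃ p q : FinPerm, glue p q = ⟨n + 1, σ⟩ := by
  obtain ⟨m, hm⟩ := σ.surjective (Fin.last n)
  have hmn : m.val < n + 1 := m.2
  have top : ∀ i, i ≠ m → (σ i).val < n := by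
    intro i hi
    have : σ i ≠ Fin.last n := fun h => hi (σ.injective (h.trans hm.symm))
    have := Fin.val_ne_of_ne this
    have := (σ i).2
    simp only [Fin.val_last] at *
    omega
  have cross : ∀ i j, i < m → m < j → σ i < σ j := by
    intro i j hi hj
    by_contra hle
    have hne : σ i ≠ σ j := fun h => (hi.trans hj).ne (σ.injective h)
    refine hσ ⟨i, m, j, hi, hj, lt_of_le_of_ne (not_lt.1 hle) hne.symm, ?_⟩
    rw [hm, Fin.lt_def, Fin.val_last]
    exact top i hi.ne
  have low : ∀ i, i < m → (σ i).val < m := by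
    intro i hi
    have hsub : (Finset.Iic (σ i)).image σ.symm ⊆ Finset.Iio m := by
      intro x hx
      obtain ⟨v, hv, rfl⟩ := Finset.mem_image.1 hx
      rw [Finset.mem_Iic] at hv
      rw [Finset.mem_Iio]
      rcases lt_trichotomy (σ.symm v) m with h | h | h
      · exact h
      · have hv' : v = Fin.last n := by rw [← hm, ← h, Equiv.apply_symm_apply]
        have := top i hi.ne
        rw [hv', Fin.le_def, Fin.val_last] at hv
        omega
      · have := cross i _ hi h
        rw [Equiv.apply_symm_apply] at this
        exact absurd hv (not_le.2 this)
    have := Finset.card_le_card hsub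
    rw [Finset.card_image_of_injective _ σ.symm.injective, Fin.card_Iic, Fin.card_Iio] at this
    omega
  have high : ∀ j, m < j → m.val ≤ σ j := by
    intro j hj
    have hsub : (Finset.Iio m).image σ ⊆ Finset.Iio (σ j) := by
      intro x hx
      obtain ⟨i, hi, rfl⟩ := Finset.mem_image.1 hx
      exact Finset.mem_Iio.2 (cross i j (Finset.mem_Iio.1 hi) hj)
    have := Finset.card_le_card hsub
    rwa [Finset.card_image_of_injective _ σ.injective, Fin.card_Iio, Fin.card_Iio] at this
  let f : Fin m.val → Fin m.val := fun i => ⟨σ ⟨i, by omega⟩, low _ i.2⟩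
  have hf : Function.Bijective f := by
    refine Finite.injective_iff_bijective.1 fun i j hij => ?_
    have hv : (f i).val = (f j).val := congrArg Fin.val hij
    have := σ.injective (Fin.ext hv)
    exact Fin.ext (Fin.mk.inj this)
  have after : ∀ i : Fin (n - m), m < (⟨m + (1 + i), by omega⟩ : Fin (n + 1)) := by
    intro i
    rw [Fin.lt_def]
    simp only
    omega
  let g : Fin (n - m) → Fin (n - m) := fun i => ⟨σ ⟨m + (1 + i), by omega⟩ - m, by
    have h₁ := top _ (after i).ne'
    have h₂ := high _ (after i)
    omega⟩
  have hg : Function.Bijective g := by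
    refine Finite.injective_iff_bijective.1 fun i j hij => ?_
    have h₁ := high _ (after i)
    have h₂ := high _ (after j)
    have h₃ := congrArg Fin.val hij
    simp only [g] at h₃
    have := congrArg Fin.val (σ.injective (Fin.ext (by omega :
      (σ ⟨m + (1 + i), _⟩).val = σ ⟨m + (1 + j), _⟩)))
    simp only at this
    exact Fin.ext (by omega)
  refine ⟨⟨m, Equiv.ofBijective f hf⟩, ⟨n - m, Equiv.ofBijective g hg⟩, ?_⟩
  set p : FinPerm := ⟨m, Equiv.ofBijective f hf⟩ with hp
  set q : FinPerm := ⟨n - m, Equiv.ofBijective g hg⟩ with hq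
  refine FinPerm.ext_val ?_ fun i hi hi' => ?_
  · simp only [glue_size, hp, hq]
    omega
  · have hx : (⟨i, hi⟩ : Fin (glue p q).1).val = i := rfl
    rcases glue_cases p q ⟨i, hi⟩ with ⟨j, hj⟩ | hj | ⟨j, hj⟩
    · rw [hj, gl_val] at hx
      subst hx
      rw [hj, glue_gl]
      rfl
    · rw [hj, gm_val] at hx
      subst hx
      rw [hj, glue_gm]
      have : (σ ⟨m, hmn⟩).val = n := by rw [show (⟨m, hmn⟩ : Fin (n + 1)) = m from rfl, hm]; rfl
      exact (show m.val + (n - m) = n by omega).trans this.symm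
    · rw [hj, gr_val] at hx
      subst hx
      rw [hj, glue_gr]
      have h₂ := high _ (after j)
      change m.val + (σ ⟨m + (1 + j), _⟩ - m.val) = (σ ⟨m + (1 + j), _⟩).val
      omega

/-- The permutation avoiding `231` encoded by a binary tree. -/
def treePerm : BinaryTree Unit → FinPerm
  | .nil => ⟨0, 1⟩
  | .node _ l r => glue (treePerm l) (treePerm r)

theorem treePerm_size (t : BinaryTree Unit) : (treePerm t).1 = t.numNodes := by
  induction t with
  | nil => rfl
  | node _ l r ihl ihr =>
    rw [treePerm, glue_size, ihl, ihr, BinaryTree.numNodes]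
    omega

theorem avoidsF_treePerm (t : BinaryTree Unit) : AvoidsF (treePerm t) := by
  induction t with
  | nil => exact fun ⟨i, _⟩ => i.elim0
  | node _ l r ihl ihr => exact avoidsF_glue_iff.2 ⟨ihl, ihr⟩

theorem treePerm_injective : Function.Injective treePerm := by
  intro s t h
  induction s generalizing t with
  | nil =>
    cases t with
    | nil => rfl
    | node _ l r =>
      have : 0 = (treePerm l).1 + (1 + (treePerm r).1) := congrArg Sigma.fst h
      omega
  | node _ l r ihl ihr =>
    cases t with
    | nil =>
      have : (treePerm l).1 + (1 + (treePerm r).1) = 0 := congrArg Sigma.fst h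
      omega
    | node _ l' r' =>
      obtain ⟨h₁, h₂⟩ := glue_injective h
      rw [ihl h₁, ihr h₂]

theorem exists_treePerm (n : ℕ) (p : FinPerm) (hn : p.1 = n) (hp : AvoidsF p) :
    ∃ t, treePerm t = p := by
  induction n using Nat.strong_induction_on generalizing p with
  | _ n ih =>
    obtain ⟨m, σ⟩ := p
    obtain rfl : m = n := hn
    cases m with
    | zero => exact ⟨.nil, FinPerm.ext_val rfl fun i hi => absurd hi (Nat.not_lt_zero i)⟩
    | succ m =>
      obtain ⟨p, q, h⟩ := exists_glue σ hp
      have hsize : p.1 + (1 + q.1) = m + 1 := congrArg Sigma.fst h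
      rw [← h, avoidsF_glue_iff] at hp
      obtain ⟨l, hl⟩ := ih p.1 (by omega) p rfl hp.1
      obtain ⟨r, hr⟩ := ih q.1 (by omega) q rfl hp.2
      exact ⟨.node () l r, by rw [treePerm, hl, hr, h]⟩

/-- Permutations avoiding `231` are counted by the Catalan numbers. -/
theorem card_avoids (n : ℕ) : Nat.card {σ : Equiv.Perm (Fin n) // Avoids σ} = catalan n := by
  rw [← BinaryTree.treesOfNumNodesEq_card_eq_catalan, ← Nat.card_eq_finsetCard]
  choose T hT using fun σ : {σ : Equiv.Perm (Fin n) // Avoids σ} =>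
    exists_treePerm n ⟨n, σ.1⟩ rfl σ.2
  refine Nat.card_eq_of_bijective (fun σ => ⟨T σ, ?_⟩) ⟨fun σ τ h => ?_, fun t => ?_⟩
  · rw [BinaryTree.mem_treesOfNumNodesEq, ← treePerm_size, hT]
  · have h' : T σ = T τ := congrArg Subtype.val h
    have := (hT σ).symm.trans ((congrArg treePerm h').trans (hT τ))
    exact Subtype.ext (eq_of_heq (Sigma.mk.inj this).2)
  · obtain ⟨t, ht⟩ := t
    rw [BinaryTree.mem_treesOfNumNodesEq, ← treePerm_size] at ht
    subst ht
    exact ⟨⟨(treePerm t).2, avoidsF_treePerm t⟩, Subtype.ext (treePerm_injective (hT _))⟩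

theorem sum_catalan_div (N : ℕ) :
    ∑ n ∈ Finset.range N, (catalan n : ℝ) * (1 / 4) ^ n =
      2 - 2 * (N.centralBinom * (1 / 4 : ℝ) ^ N) := by
  induction N with
  | zero => simp
  | succ N ih =>
    have h₁ : ((N : ℝ) + 1) * catalan N = N.centralBinom := by
      exact_mod_cast succ_mul_catalan_eq_centralBinom N
    have h₂ : ((N : ℝ) + 1) * (N + 1).centralBinom = 2 * (2 * N + 1) * N.centralBinom := by
      exact_mod_cast Nat.succ_mul_centralBinom_succ N
    have h₃ : (N + 1).centralBinom = (4 * N + 2) * (catalan N : ℝ) := by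
      have : (N : ℝ) + 1 ≠ 0 := by positivity
      apply mul_left_cancel₀ this
      rw [h₂, ← h₁]
      ring
    rw [Finset.sum_range_succ, ih, h₃, ← h₁, pow_succ]
    ring

theorem centralBinom_sq_le (N : ℕ) :
    (N.centralBinom * (1 / 4 : ℝ) ^ N) ^ 2 * (2 * N + 1) ≤ 1 := by
  induction N with
  | zero => simp
  | succ N ih =>
    have h₂ : ((N : ℝ) + 1) * (N + 1).centralBinom = 2 * (2 * N + 1) * N.centralBinom := by
      exact_mod_cast Nat.succ_mul_centralBinom_succ N
    have hN : (0 : ℝ) < N + 1 := by positivity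
    have h₃ : ((N + 1).centralBinom : ℝ) = 2 * (2 * N + 1) * N.centralBinom / (N + 1) := by
      rw [eq_div_iff hN.ne', ← h₂]
      ring
    refine le_trans ?_ ih
    rw [h₃, pow_succ (1 / 4 : ℝ)]
    push_cast
    have : (2 * (2 * (N : ℝ) + 1) * N.centralBinom / (N + 1) * ((1 / 4) ^ N * (1 / 4))) ^ 2 *
        (2 * (N + 1) + 1) = (N.centralBinom * (1 / 4 : ℝ) ^ N) ^ 2 * (2 * N + 1) *
        (((2 * N + 1) * (2 * N + 3)) / (2 * (N + 1)) ^ 2) := by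
      field_simp
      ring
    rw [this]
    refine mul_le_of_le_one_right (by positivity) ?_
    rw [div_le_one (by positivity)]
    nlinarith

theorem tendsto_centralBinom_div :
    Tendsto (fun N : ℕ => (N.centralBinom * (1 / 4 : ℝ) ^ N)) atTop (𝓝 0) := by
  have h : Tendsto (fun N : ℕ => (N.centralBinom * (1 / 4 : ℝ) ^ N) ^ 2) atTop (𝓝 0) := by
    refine squeeze_zero (fun N => by positivity) (fun N => ?_)
      (tendsto_one_div_add_atTop_nhds_zero_nat (𝕜 := ℝ))
    rw [le_div_iff₀ (by positivity)]
    refine le_trans ?_ (centralBinom_sq_le N)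
    gcongr
    linarith [(Nat.cast_nonneg N : (0 : ℝ) ≤ N)]
  have := h.sqrt
  rw [Real.sqrt_zero] at this
  refine this.congr fun N => Real.sqrt_sq (by positivity)

theorem hasSum_catalan_quarter : HasSum (fun n => (catalan n : ℝ) * (1 / 4) ^ n) 2 := by
  rw [hasSum_iff_tendsto_nat_of_nonneg fun n => by positivity]
  simp only [sum_catalan_div]
  simpa using tendsto_const_nhds.sub (tendsto_centralBinom_div.const_mul 2)

theorem catGF_quarter : catGF (1 / 4) = 2 := by
  have := Complex.hasSum_ofReal.2 hasSum_catalan_quarter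
  rw [catGF, ← show ((2 : ℝ) : ℂ) = 2 by norm_num, ← this.tsum_eq]
  push_cast
  rfl

/-- Sorting a class of permutations by size. -/
def sizeSigmaEquiv (P : FinPerm → Prop) :
    (Σ n : ℕ, {σ : Equiv.Perm (Fin n) // P ⟨n, σ⟩}) ≃ {p : FinPerm // P p} where
  toFun x := ⟨⟨x.1, x.2.1⟩, x.2.2⟩
  invFun p := ⟨p.1.1, p.1.2, p.2⟩
  left_inv _ := rfl
  right_inv _ := rfl

theorem tsum_pow_size (P : FinPerm → Prop) {z : ℂ}
    (h : Summable fun p : {p : FinPerm // P p} => z ^ p.1.1) :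
    ∑' p : {p : FinPerm // P p}, z ^ p.1.1 =
      ∑' n : ℕ, (Nat.card {σ : Equiv.Perm (Fin n) // P ⟨n, σ⟩} : ℂ) * z ^ n := by
  rw [← (sizeSigmaEquiv P).tsum_eq]
  refine (Summable.tsum_sigma ((sizeSigmaEquiv P).summable_iff.2 h)).trans ?_
  refine tsum_congr fun n => ?_
  simp [sizeSigmaEquiv]

theorem summable_pow_size {z : ℂ} (hz : ‖z‖ ≤ 1 / 4) :
    Summable fun p : {p : FinPerm // AvoidsF p} => z ^ p.1.1 := by
  refine Summable.of_norm ?_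
  rw [← (sizeSigmaEquiv AvoidsF).summable_iff]
  refine (summable_sigma_of_nonneg fun _ => norm_nonneg _).2 ⟨fun n => Summable.of_finite, ?_⟩
  refine Summable.of_nonneg_of_le (fun n => tsum_nonneg fun _ => norm_nonneg _) (fun n => ?_)
    hasSum_catalan_quarter.summable
  rw [← card_avoids]
  simp only [sizeSigmaEquiv, Equiv.coe_fn_mk, norm_pow, tsum_const,
    nsmul_eq_mul]
  exact mul_le_mul_of_nonneg_left (pow_le_pow_left₀ (norm_nonneg z) hz n) (Nat.cast_nonneg _)

theorem hasSum_pow_size {z : ℂ} (hz : ‖z‖ ≤ 1 / 4) :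
    HasSum (fun p : {p : FinPerm // AvoidsF p} => z ^ p.1.1) (catGF z) := by
  convert (summable_pow_size hz).hasSum using 1
  rw [tsum_pow_size AvoidsF (summable_pow_size hz), catGF]
  refine tsum_congr fun n => ?_
  rw [← card_avoids]
  rfl

/-- The realized types partition the permutations avoiding `231`. -/
theorem hasSum_Ct (k : ℕ) {z : ℂ} (hz : ‖z‖ ≤ 1 / 4) :
    HasSum (fun t : Tk k => Ct k t.1 z) (catGF z) := by
  let g : {p : FinPerm // AvoidsF p} → Tk k := fun p => ⟨typeOf k p.1, p.1, p.2, rfl⟩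
  refine Eq.mp (congrArg (HasSum · _) (funext fun t => Eq.symm ?_)) ((hasSum_pow_size hz).tsum_fiberwise g)
  let e : {p : FinPerm // AvoidsF p ∧ typeOf k p = t.1} ≃ g ⁻¹' {t} :=
    { toFun := fun p => ⟨⟨p.1, p.2.1⟩, Subtype.ext p.2.2⟩
      invFun := fun p => ⟨p.1.1, p.1.2, congrArg Subtype.val p.2⟩
      left_inv := fun _ => rfl
      right_inv := fun _ => rfl }
  rw [← e.tsum_eq]
  exact (tsum_pow_size (fun p => AvoidsF p ∧ typeOf k p = t.1)
    (e.summable_iff.2 ((summable_pow_size hz).subtype (g ⁻¹' {t})))).symm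

/-- Summing the series `C_v` along the fibers of a self-map of the realized types. -/
theorem hasSum_fiber_Ct (k : ℕ) {z : ℂ} (hz : ‖z‖ ≤ 1 / 4) (h : QT k → QT k)
    (hh : ∀ v, Realized k v → Realized k (h v)) :
    HasSum (fun t : Tk k => ∑' v : {v : QT k // Realized k v ∧ h v = t.1}, Ct k v.1 z)
      (catGF z) := by
  let g : Tk k → Tk k := fun v => ⟨h v.1, hh v.1 v.2⟩
  refine Eq.mp (congrArg (HasSum · _) (funext fun t => Eq.symm ?_)) ((hasSum_Ct k hz).tsum_fiberwise g)
  let e : {v : QT k // Realized k v ∧ h v = t.1} ≃ g ⁻¹' {t} :=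
    { toFun := fun v => ⟨⟨v.1, v.2.1⟩, Subtype.ext v.2.2⟩
      invFun := fun v => ⟨v.1.1, v.1.2, congrArg Subtype.val v.2⟩
      left_inv := fun _ => rfl
      right_inv := fun _ => rfl }
  rw [← e.tsum_eq]
  rfl

theorem tsum_Mmat (k : ℕ) {z : ℂ} (hz : ‖z‖ ≤ 1 / 4) {u : QT k} (hu : Realized k u) :
    ∑' t : Tk k, Mmat k z t.1 u = 2 * z * catGF z := by
  have h₁ := hasSum_fiber_Ct k hz (fun v => Hfun k u v) fun _ hv => hu.Hfun hv
  have h₂ := hasSum_fiber_Ct k hz (fun v => Hfun k v u) fun _ hv => hv.Hfun hu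
  rw [show 2 * z * catGF z = z * (catGF z + catGF z) by ring]
  exact ((h₁.add h₂).mul_left z).tsum_eq

/-- For `|z| ≤ 1/4`, every column sum of the Jacobian matrix `M_k(z)` equals `2z C(z)`;
in particular at `z = 1/4` every column sum equals `1`. -/
theorem jacobian_column_sums (k : ℕ) (hk : 2 ≤ k) :
    (∀ z : ℂ, ‖z‖ ≤ 1 / 4 → ∀ u : QT k, Realized k u →
      ∑' t : Tk k, Mmat k z t.1 u = 2 * z * catGF z) ∧
    (∀ u : QT k, Realized k u → ∑' t : Tk k, Mmat k ((1 : ℂ) / 4) t.1 u = 1) := by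
  refine ⟨fun z hz u hu => tsum_Mmat k hz hu, fun u hu => ?_⟩
  rw [tsum_Mmat k (by norm_num) hu, catGF_quarter]
  norm_num

end Av231
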